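/- arXiv:2605.00949 — 3 statements merged into one kernel-verified Lean document; each statement's English description precedes it below -/
import Mathlib

section
/- Let F(x) = (x^k + b)^n + c·∑_{i=1}^{n} (a(x^k + b))^{n-i} ∈ ℤ[x] be irreducible of degree nk over ℚ, let θ be a root of F, and K = ℚ(θ). Let p be a prime divisor of the discriminant 𝔇_F with p ∣ c. Then p does not divide the index [ℤ_K : ℤ[θ]] if and only if p² ∤ c. -/
open Polynomial

/-- `D` is the discriminant of the integer polynomial `f`: writing the roots of `f`
in `ℂ` as `θ_1, …, θ_d` (so that `f` splits as `∏ (X - θ_i)` over `ℂ`),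
`D = ∏_{i < j} (θ_i - θ_j)^2`. -/
def IsDiscriminant (f : Polynomial ℤ) (D : ℤ) : Prop :=
  ∃ θ : Fin f.natDegree → ℂ,
    f.map (algebraMap ℤ ℂ) = ∏ i, (X - C (θ i)) ∧
      (D : ℂ) = ∏ i, ∏ j ∈ Finset.Ioi i, (θ i - θ j) ^ 2

theorem exists_eq_C_mul_of_map_eq_zero {p : ℕ} {P : ℤ[X]}
    (h : P.map (Int.castRingHom (ZMod p)) = 0) : ∃ Q : ℤ[X], P = C (p : ℤ) * Q := by
  have : C (p : ℤ) ∣ P := by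
    rw [C_dvd_iff_dvd_coeff]
    intro i
    rw [← ZMod.intCast_zmod_eq_zero_iff_dvd]
    simpa using congrArg (fun q => q.coeff i) h
  exact this

theorem dvd_sum_pow_sub_sub_one {R : Type*} [CommRing R] (n : ℕ) (hn : 1 ≤ n) (y : R) :
    y ∣ ∑ i ∈ Finset.Icc 1 n, y ^ (n - i) - 1 := by
  obtain ⟨m, rfl⟩ : ∃ m, n = m + 1 := ⟨n - 1, by omega⟩
  rw [Finset.sum_Icc_succ_top (by omega)]
  simp only [Nat.sub_self, pow_zero, add_sub_cancel_right]
  refine Finset.dvd_sum fun i hi => dvd_pow_self _ ?_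
  have := (Finset.mem_Icc.mp hi).2
  omega

theorem monic_pow_add_C_mul_sum {g : ℤ[X]} (hg : g.Monic) (hdeg : 1 ≤ g.natDegree)
    {n : ℕ} (hn : 1 ≤ n) (a c : ℤ) :
    (g ^ n + C c * ∑ i ∈ Finset.Icc 1 n, (C a * g) ^ (n - i)).Monic := by
  refine (hg.pow n).add_of_left (degree_lt_degree ?_)
  rw [hg.natDegree_pow]
  refine ((natDegree_C_mul_le _ _).trans (natDegree_sum_le_of_forall_le (n := (n - 1) * g.natDegree)
    _ _ fun i hi => ?_)).trans_lt ?_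
  · refine (natDegree_pow_le_of_le _ (natDegree_C_mul_le _ _)).trans ?_
    have := (Finset.mem_Icc.mp hi).1
    exact Nat.mul_le_mul_right _ (by omega)
  · exact Nat.mul_lt_mul_of_pos_right (by omega) (by omega)

theorem dvd_index_of_nsmul_mem {G : Type*} [AddCommGroup G] (H : AddSubgroup G) {p : ℕ}
    (hp : p.Prime) {x : G} (hx : x ∉ H) (hpx : p • x ∈ H) : p ∣ H.index := by
  have := Fact.mk hp
  have h : addOrderOf (x : G ⧸ H) = p := by
    refine addOrderOf_eq_prime ?_ ?_
    · rw [← QuotientAddGroup.mk_nsmul, QuotientAddGroup.eq_zero_iff]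
      exact hpx
    · rwa [Ne, QuotientAddGroup.eq_zero_iff]
  rw [AddSubgroup.index, ← h]
  exact addOrderOf_dvd_natCard _

theorem exists_nsmul_mem_of_dvd_index {G : Type*} [AddCommGroup G] (H : AddSubgroup G) {p : ℕ}
    (hp : p.Prime) (h0 : H.index ≠ 0) (h : p ∣ H.index) : ∃ x ∉ H, p • x ∈ H := by
  have := Fact.mk hp
  have : Finite (G ⧸ H) := Nat.finite_of_card_ne_zero h0
  obtain ⟨q, hq⟩ := exists_prime_addOrderOf_dvd_card' p h
  obtain ⟨x, rfl⟩ := QuotientAddGroup.mk_surjective q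
  refine ⟨x, fun hx => ?_, ?_⟩
  · rw [(QuotientAddGroup.eq_zero_iff x).mpr hx, addOrderOf_zero] at hq
    exact hp.one_lt.ne hq
  · rw [← QuotientAddGroup.eq_zero_iff, QuotientAddGroup.mk_nsmul, ← hq]
    exact addOrderOf_nsmul_eq_zero _

theorem index_adjoin_ne_zero {K : Type*} [Field K] [NumberField K]
    (θ : NumberField.RingOfIntegers K) (hgen : Algebra.adjoin ℚ {(θ : K)} = ⊤) :
    (Algebra.adjoin ℤ {θ}).toSubring.toAddSubgroup.index ≠ 0 := by
  set H := (Algebra.adjoin ℤ {θ}).toSubring.toAddSubgroup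
  have key : ∀ x : NumberField.RingOfIntegers K, ∃ m : ℕ, 0 < m ∧ m • x ∈ H := by
    intro x
    have hx : (x : K) ∈ Algebra.adjoin ℚ {(θ : K)} := hgen ▸ Algebra.mem_top
    rw [Algebra.adjoin_singleton_eq_range_aeval] at hx
    obtain ⟨q, hq⟩ := hx
    obtain ⟨b, hbmem, hb⟩ := IsLocalization.integerNormalization_spec (nonZeroDivisors ℤ) q
    have hb0 : b ≠ 0 := nonZeroDivisors.ne_zero hbmem
    have hbx : b • x = aeval θ (IsLocalization.integerNormalization (nonZeroDivisors ℤ) q) := by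
      apply NumberField.RingOfIntegers.coe_injective
      have := congrArg (aeval (θ : K)) hb
      rw [aeval_map_algebraMap, map_zsmul] at this
      change algebraMap _ K (b • x) = algebraMap _ K _
      rw [map_zsmul, ← aeval_algebraMap_apply]
      refine Eq.trans ?_ this.symm
      congr 1
      exact hq.symm
    have hmem : b • x ∈ H := by
      rw [hbx]
      exact aeval_mem_adjoin_singleton _ _
    refine ⟨b.natAbs, Int.natAbs_pos.mpr hb0, ?_⟩
    rcases Int.natAbs_eq b with h | h
    · rw [h, natCast_zsmul] at hmem
      exact hmem
    · rw [h, neg_smul, natCast_zsmul, neg_mem_iff] at hmem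
      exact hmem
  have tors : IsAddTorsion (NumberField.RingOfIntegers K ⧸ H) := by
    intro q
    obtain ⟨x, rfl⟩ := QuotientAddGroup.mk_surjective q
    obtain ⟨m, hm, hx⟩ := key x
    rw [isOfFinAddOrder_iff_nsmul_eq_zero]
    exact ⟨m, hm, by rwa [← QuotientAddGroup.mk_nsmul, QuotientAddGroup.eq_zero_iff]⟩
  have : AddGroup.FG (NumberField.RingOfIntegers K) :=
    Module.Finite.iff_addGroup_fg.mp inferInstance
  have := AddCommGroup.finite_of_fg_isAddTorsion _ tors
  exact AddSubgroup.index_ne_zero_of_finite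

/-- If `g` lies in `(φ, p)` and `g ^ n + c * S` lies in `(φ, p ^ 2)`, where `n ≥ 2`, `p ∣ c` and
`S ≡ 1` modulo `g`, then `c` lies in `(φ, p ^ 2)`; this forces `p ^ 2 ∣ c` when `φ` is irreducible
modulo `p`. -/
theorem sq_dvd_of_mem_span {p : ℕ} (hp : p.Prime) {n : ℕ} (hn : 2 ≤ n) {c : ℤ}
    (hpc : (p : ℤ) ∣ c) {φ g S A B q r t : ℤ[X]}
    (hφ : Irreducible (φ.map (Int.castRingHom (ZMod p))))
    (hg : g = φ * q + C (p : ℤ) * r) (hS : S = 1 + g * t)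
    (hF : g ^ n + C c * S = φ * A + C (p : ℤ) ^ 2 * B) : (p : ℤ) ^ 2 ∣ c := by
  have := Fact.mk hp
  obtain ⟨d, rfl⟩ := hpc
  obtain ⟨m, rfl⟩ : ∃ m, n = m + 2 := ⟨n - 2, by omega⟩
  obtain ⟨A', B', h⟩ : ∃ A' B' : ℤ[X], C ((p : ℤ) * d) = φ * A' + C (p : ℤ) ^ 2 * B' := by
    refine ⟨A - g ^ m * (φ * q ^ 2 + 2 * q * C (p : ℤ) * r) - C (p : ℤ) * C d * q * t,
      B - g ^ m * r ^ 2 - C d * r * t, ?_⟩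
    have h1 : g ^ (m + 2) = g ^ m * (φ * q + C (p : ℤ) * r) ^ 2 := by rw [pow_add, ← hg]
    rw [h1, hS, C_mul] at hF
    have h2 : g * t = (φ * q + C (p : ℤ) * r) * t := by rw [← hg]
    rw [h2] at hF
    rw [C_mul]
    linear_combination hF
  have hA : A'.map (Int.castRingHom (ZMod p)) = 0 := by
    have := congrArg (map (Int.castRingHom (ZMod p))) h
    simp only [Polynomial.map_add, Polynomial.map_mul, Polynomial.map_pow, map_C] at this
    simpa [hφ.ne_zero] using this
  obtain ⟨A₁, rfl⟩ := exists_eq_C_mul_of_map_eq_zero hA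
  have hp0 : (C (p : ℤ) : ℤ[X]) ≠ 0 := by simpa using hp.ne_zero
  have h' : C d = φ * A₁ + C (p : ℤ) * B' := by
    apply mul_left_cancel₀ hp0
    rw [← C_mul, h]
    ring
  have h3 := congrArg (map (Int.castRingHom (ZMod p))) h'
  simp only [Polynomial.map_add, Polynomial.map_mul, map_C] at h3
  have h4 : φ.map (Int.castRingHom (ZMod p)) ∣ C ((d : ZMod p)) := ⟨_, by simpa using h3⟩
  have h5 : (d : ZMod p) = 0 := by
    by_contra hd
    exact hφ.not_isUnit (isUnit_of_dvd_unit h4 (isUnit_C.mpr (Ne.isUnit hd)))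
  rw [ZMod.intCast_zmod_eq_zero_iff_dvd] at h5
  rw [pow_two]
  exact mul_dvd_mul_left _ h5

theorem dvd_of_aeval_eq_zero {K : Type*} [Field K] [NumberField K]
    {θ : NumberField.RingOfIntegers K} {F : ℤ[X]} (hmonic : F.Monic)
    (hirr : Irreducible (F.map (algebraMap ℤ ℚ))) (hθ : aeval θ F = 0) {P : ℤ[X]}
    (hP : aeval θ P = 0) : F ∣ P := by
  have hint : IsIntegral ℤ θ := ⟨F, hmonic, by simpa [aeval_def] using hθ⟩
  have hF : Irreducible F := (hmonic.irreducible_iff_irreducible_map_fraction_map (K := ℚ)).mpr hirr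
  have h1 := minpoly.isIntegrallyClosed_dvd hint hθ
  have h2 := (minpoly.irreducible hint).dvd_symm hF h1
  exact h2.trans (minpoly.isIntegrallyClosed_dvd hint hP)

/-- The implication of Dedekind's criterion giving `p`-maximality of `ℤ[θ]`: if an algebraic
integer `x` outside `ℤ[θ]` has `p x ∈ ℤ[θ]`, then modulo `p ^ 2` the polynomial `F` is a multiple of
some `φ` which is irreducible modulo `p`. -/
theorem exists_irreducible_dvd_mod_sq {K : Type*} [Field K] [NumberField K]
    {θ : NumberField.RingOfIntegers K} {F : ℤ[X]} (hmonic : F.Monic)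
    (hker : ∀ P : ℤ[X], aeval θ P = 0 → F ∣ P) (hθ : aeval θ F = 0)
    {p : ℕ} (hp : p.Prime) {x : NumberField.RingOfIntegers K}
    (hx : x ∉ Algebra.adjoin ℤ {θ}) (hpx : p • x ∈ Algebra.adjoin ℤ {θ}) :
    ∃ φ A B : ℤ[X], Irreducible (φ.map (Int.castRingHom (ZMod p))) ∧
      F = φ * A + C (p : ℤ) ^ 2 * B := by
  have := Fact.mk hp
  set π := Int.castRingHom (ZMod p)
  have hπ : Function.Surjective (map π) := map_surjective π (ZMod.ringHom_surjective π)
  have hp0 : (p : NumberField.RingOfIntegers K) ≠ 0 := by exact_mod_cast hp.ne_zero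
  rw [Algebra.adjoin_singleton_eq_range_aeval] at hx hpx
  obtain ⟨G, hG⟩ := hpx
  replace hG : aeval θ G = p * x := by simpa using hG
  have hnd : ¬ F.map π ∣ G.map π := by
    rintro ⟨E, hE⟩
    obtain ⟨E, rfl⟩ := hπ E
    obtain ⟨Q, hQ⟩ := exists_eq_C_mul_of_map_eq_zero (p := p) (P := G - F * E)
      (by rw [Polynomial.map_sub, Polynomial.map_mul, hE, sub_self])
    refine hx ⟨Q, mul_left_cancel₀ hp0 ?_⟩
    have := congrArg (aeval θ) hQ
    simp only [map_sub, map_mul, hθ, hG, zero_mul, sub_zero, aeval_C] at this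
    simpa using this.symm
  have hF0 : F.map π ≠ 0 := (hmonic.map π).ne_zero
  obtain ⟨e, he⟩ := EuclideanDomain.gcd_dvd_right (G.map π) (F.map π)
  have heu : ¬ IsUnit e := fun hu => hnd <| by
    have h1 : F.map π ∣ EuclideanDomain.gcd (G.map π) (F.map π) :=
      (dvd_of_eq he).trans (hu.mul_right_dvd.mpr dvd_rfl)
    exact h1.trans (EuclideanDomain.gcd_dvd_left _ _)
  have he0 : e ≠ 0 := by
    rintro rfl
    exact hF0 (by rw [he, mul_zero])
  obtain ⟨φ₀, hφ, e', rfl⟩ := WfDvdMonoid.exists_irreducible_factor heu he0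
  obtain ⟨φ, rfl⟩ := hπ φ₀
  obtain ⟨E, rfl⟩ := hπ e'
  obtain ⟨U, hU⟩ := hπ (EuclideanDomain.gcdA (G.map π) (F.map π))
  obtain ⟨V, hV⟩ := hπ (EuclideanDomain.gcdB (G.map π) (F.map π))
  have hgcd := EuclideanDomain.gcd_eq_gcd_ab (G.map π) (F.map π)
  rw [← hU, ← hV] at hgcd
  obtain ⟨M, hM⟩ := exists_eq_C_mul_of_map_eq_zero (p := p) (P := F - φ * ((G * U + F * V) * E)) (by
    rw [Polynomial.map_sub, sub_eq_zero, he, hgcd]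
    simp only [Polynomial.map_mul, Polynomial.map_add]
    change _ = map π φ * _
    ring)
  have hMθ : aeval θ M = -(aeval θ φ * (aeval θ U * aeval θ E * x)) := by
    apply mul_left_cancel₀ hp0
    have := congrArg (aeval θ) hM
    simp only [map_sub, map_add, map_mul, hθ, hG, zero_mul, add_zero, zero_sub, aeval_C] at this
    have h2 : algebraMap ℤ (NumberField.RingOfIntegers K) p = p := by simp
    rw [h2] at this
    rw [← this]
    ring
  by_cases hdvd : φ.map π ∣ M.map π
  · obtain ⟨Q, hQ⟩ := hdvd
    obtain ⟨Q, rfl⟩ := hπ Q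
    obtain ⟨T, hT⟩ := exists_eq_C_mul_of_map_eq_zero (p := p) (P := M - φ * Q)
      (by rw [Polynomial.map_sub, Polynomial.map_mul, hQ, sub_self])
    refine ⟨φ, (G * U + F * V) * E + C (p : ℤ) * Q, T, hφ, ?_⟩
    linear_combination hM + C (p : ℤ) * hT
  · exfalso
    have : (Ideal.span {φ.map π}).IsMaximal := PrincipalIdealRing.isMaximal_of_irreducible hφ
    let I : Ideal ℤ[X] := (Ideal.span {φ.map π}).comap (mapRingHom π)
    have : I.IsMaximal := Ideal.comap_isMaximal_of_surjective (mapRingHom π) hπ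
    let _ := ((aeval θ : ℤ[X] →ₐ[ℤ] _) : ℤ[X] →+* NumberField.RingOfIntegers K).toAlgebra
    have halg : ∀ P : ℤ[X], algebraMap ℤ[X] (NumberField.RingOfIntegers K) P = aeval θ P :=
      fun _ => rfl
    have : IsScalarTower ℤ ℤ[X] (NumberField.RingOfIntegers K) :=
      IsScalarTower.of_algebraMap_eq fun z => by simp [halg]
    have : Algebra.IsIntegral ℤ[X] (NumberField.RingOfIntegers K) :=
      Algebra.IsIntegral.tower_top ℤ
    have hmem : ∀ P : ℤ[X], P ∈ I ↔ φ.map π ∣ P.map π := fun P => Ideal.mem_span_singleton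
    obtain ⟨Q, hQ, hQI⟩ := Ideal.exists_ideal_over_maximal_of_isIntegral
      (S := NumberField.RingOfIntegers K) I fun P hP => by
        rw [hmem]
        refine (Dvd.intro (E.map π * EuclideanDomain.gcd (G.map π) (F.map π)) ?_).trans
          (map_dvd (mapRingHom π) (hker P hP))
        rw [coe_mapRingHom]
        refine Eq.trans ?_ he.symm
        ring
    have hQmem : ∀ P : ℤ[X], aeval θ P ∈ Q ↔ φ.map π ∣ P.map π := fun P => by
      rw [← hmem, ← hQI, Ideal.mem_comap, halg]
    have hφQ : aeval θ φ ∈ Q := (hQmem φ).mpr dvd_rfl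
    refine hdvd ((hQmem M).mp ?_)
    rw [hMθ]
    exact Q.neg_mem (Q.mul_mem_right _ hφQ)

theorem exists_natCast_mul_eq_pow {K : Type*} [Field K] [NumberField K]
    {n : ℕ} (hn : 2 ≤ n) {p : ℕ} (hp : p.Prime)
    {y r : NumberField.RingOfIntegers K} (h : y ^ n = (p : NumberField.RingOfIntegers K) ^ 2 * r) :
    ∃ x : NumberField.RingOfIntegers K, p * x = y ^ (n - 1) := by
  obtain ⟨m, rfl⟩ : ∃ m, n = m + 2 := ⟨n - 2, by omega⟩
  have hp0 : (p : K) ≠ 0 := by exact_mod_cast hp.ne_zero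
  have hK : (y : K) ^ (m + 2) = (p : K) ^ 2 * r := by
    have := congrArg (algebraMap _ K) h
    simpa using this
  have hint : IsIntegral ℤ ((y : K) ^ (m + 1) / p) := by
    refine IsIntegral.of_pow (n := m + 2) (by omega) ?_
    have : ((y : K) ^ (m + 1) / p) ^ (m + 2) =
        ((p ^ m * r ^ (m + 1) : NumberField.RingOfIntegers K) : K) := by
      rw [div_pow, ← pow_mul, mul_comm (m + 1), pow_mul, hK, div_eq_iff (pow_ne_zero _ hp0)]
      push_cast
      ring
    rw [this]
    exact NumberField.RingOfIntegers.isIntegral_coe _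
  obtain ⟨x, hx⟩ : ∃ x : NumberField.RingOfIntegers K,
      algebraMap (NumberField.RingOfIntegers K) K x = (y : K) ^ (m + 1) / p :=
    ⟨⟨_, hint⟩, rfl⟩
  refine ⟨x, NumberField.RingOfIntegers.coe_injective ?_⟩
  change algebraMap _ K (p * x) = algebraMap _ K (y ^ (m + 1))
  rw [map_mul, map_natCast, map_pow, hx]
  field_simp

theorem stmt_3
    (n k : ℕ) (hn : 3 ≤ n) (hk : 1 ≤ k) (a b c : ℤ)
    (F : Polynomial ℤ)
    (hF : F = (X ^ k + C b) ^ n +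
        C c * ∑ i ∈ Finset.Icc 1 n, (C a * (X ^ k + C b)) ^ (n - i))
    (hFdeg : F.natDegree = n * k)
    (hFirr : Irreducible (F.map (algebraMap ℤ ℚ)))
    (K : Type*) [Field K] [NumberField K]
    (θ : NumberField.RingOfIntegers K)
    (hθ : aeval θ F = 0)
    (hgen : Algebra.adjoin ℚ {(θ : K)} = ⊤)
    (D : ℤ) (hD : IsDiscriminant F D)
    (p : ℕ) (hp : p.Prime) (hpD : (p : ℤ) ∣ D)
    (hpc : (p : ℤ) ∣ c) :
    (¬ p ∣ (Algebra.adjoin ℤ {θ}).toSubring.toAddSubgroup.index) ↔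
      ¬ (p : ℤ) ^ 2 ∣ c := by
  have hn1 : 1 ≤ n := by omega
  have hgmonic : (X ^ k + C b : ℤ[X]).Monic := monic_X_pow_add_C b (by omega)
  have hgdeg : (X ^ k + C b : ℤ[X]).natDegree = k := natDegree_X_pow_add_C
  set g : ℤ[X] := X ^ k + C b
  have hmonic : F.Monic := hF ▸ monic_pow_add_C_mul_sum hgmonic (by omega) hn1 a c
  have hker : ∀ P : ℤ[X], aeval θ P = 0 → F ∣ P := fun P hP =>
    dvd_of_aeval_eq_zero hmonic hFirr hθ hP
  obtain ⟨s, hs⟩ := dvd_sum_pow_sub_sub_one n hn1 (C a * g)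
  set S : ℤ[X] := ∑ i ∈ Finset.Icc 1 n, (C a * g) ^ (n - i)
  have := Fact.mk hp
  have hcp : (c : ZMod p) = 0 := (ZMod.intCast_zmod_eq_zero_iff_dvd c p).mpr hpc
  have hFg : F.map (Int.castRingHom (ZMod p)) = g.map (Int.castRingHom (ZMod p)) ^ n := by
    rw [hF, Polynomial.map_add, Polynomial.map_mul, map_C, eq_intCast, hcp, C_0, zero_mul,
      add_zero, Polynomial.map_pow]
  refine not_congr ⟨fun hdvd => ?_, fun hpc2 => ?_⟩
  · obtain ⟨x, hx, hpx⟩ := exists_nsmul_mem_of_dvd_index _ hp (index_adjoin_ne_zero θ hgen) hdvd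
    obtain ⟨φ, A, B, hφ, hFφ⟩ := exists_irreducible_dvd_mod_sq hmonic hker hθ hp hx hpx
    have hφg : φ.map (Int.castRingHom (ZMod p)) ∣ g.map (Int.castRingHom (ZMod p)) := by
      refine hφ.prime.dvd_of_dvd_pow (n := n) ?_
      rw [← hFg, hFφ]
      simp
    obtain ⟨q, hq⟩ := hφg
    obtain ⟨q, rfl⟩ := map_surjective _ (ZMod.ringHom_surjective (Int.castRingHom (ZMod p))) q
    obtain ⟨r, hr⟩ := exists_eq_C_mul_of_map_eq_zero (p := p) (P := g - φ * q)
      (by rw [Polynomial.map_sub, Polynomial.map_mul, hq, sub_self])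
    exact sq_dvd_of_mem_span hp (by omega) hpc (S := S) (t := C a * s) (q := q) (r := r) hφ
      (by linear_combination hr) (by linear_combination hs) (hF.symm.trans hFφ)
  · obtain ⟨d, hd⟩ := hpc2
    have hγ : (aeval θ g) ^ n =
        (p : NumberField.RingOfIntegers K) ^ 2 *
          (-(d : NumberField.RingOfIntegers K) * aeval θ S) := by
      have h := hθ
      rw [hF, hd] at h
      simp only [map_add, map_mul, map_pow, aeval_C] at h
      simp only [eq_intCast, Int.cast_natCast] at h
      linear_combination h
    obtain ⟨x, hx⟩ := exists_natCast_mul_eq_pow (by omega) hp hγ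
    refine dvd_index_of_nsmul_mem _ hp (x := x) (fun hmem => ?_) ?_
    · replace hmem : x ∈ Algebra.adjoin ℤ {θ} := hmem
      rw [Algebra.adjoin_singleton_eq_range_aeval] at hmem
      obtain ⟨q, rfl⟩ := hmem
      have h0 : F ∣ g ^ (n - 1) - C (p : ℤ) * q := hker _ (by
        simp only [map_sub, map_mul, map_pow, aeval_C]
        simp only [eq_intCast, Int.cast_natCast]
        exact sub_eq_zero.mpr hx.symm)
      have h1 := Polynomial.map_dvd (Int.castRingHom (ZMod p)) h0
      have h2 : g.map (Int.castRingHom (ZMod p)) ^ n ∣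
          g.map (Int.castRingHom (ZMod p)) ^ (n - 1) := by
        rw [← hFg]
        simpa using h1
      have hgm := hgmonic.map (Int.castRingHom (ZMod p))
      have hu : ¬ IsUnit (g.map (Int.castRingHom (ZMod p))) := fun hu => by
        have h4 := natDegree_eq_zero_of_isUnit hu
        rw [hgmonic.natDegree_map, hgdeg] at h4
        omega
      have h3 := (pow_dvd_pow_iff hgm.ne_zero hu).mp h2
      omega
    · change p • x ∈ Algebra.adjoin ℤ {θ}
      rw [nsmul_eq_mul, hx, ← map_pow]
      exact aeval_mem_adjoin_singleton _ _
end

section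
/- Let F(x) = (x^k + b)^n + c·∑_{i=1}^{n} (a(x^k + b))^{n-i} ∈ ℤ[x] be irreducible of degree nk over ℚ, let θ be a root of F, and K = ℚ(θ). Let p be a prime divisor of the discriminant 𝔇_F with p ∤ c and p ∣ k, and write k = p^j s′ with p ∤ s′. Set h(x) = (x^{s′} + b)^n + c·∑_{i=1}^{n} (a(x^{s′} + b))^{n-i}. Then p does not divide the index [ℤ_K : ℤ[θ]] if and only if the polynomials (1/p)·(F(x) − h(x)^{p^j}) and h(x) are coprime modulo p. -/
open Polynomial

namespace Polynomial

theorem exists_eq_add_C_mul_of_map_intCast_zmod_eq {p : ℕ} {f g : ℤ[X]}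
    (hfg : f.map (Int.castRingHom (ZMod p)) = g.map (Int.castRingHom (ZMod p))) :
    ∃ r : ℤ[X], f = g + C (p : ℤ) * r := by
  have hdvd : C (p : ℤ) ∣ f - g := by
    rw [C_dvd_iff_dvd_coeff]
    intro i
    have hi := congrArg (fun q : (ZMod p)[X] => q.coeff i) hfg
    simp only [coeff_map, eq_intCast] at hi
    rw [← ZMod.intCast_zmod_eq_zero_iff_dvd, coeff_sub, Int.cast_sub, hi, sub_self]
  obtain ⟨r, hr⟩ := hdvd
  exact ⟨r, by rw [← hr]; ring⟩

theorem map_intCast_zmod_surjective (p : ℕ) :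
    Function.Surjective (fun f : ℤ[X] => f.map (Int.castRingHom (ZMod p))) :=
  map_surjective _ (ZMod.ringHom_surjective _)

/-- Adding lower powers of a nonconstant monic `g` to `g ^ n` keeps it monic. -/
theorem Monic.pow_add_C_mul_sum {R : Type*} [CommRing R] [Nontrivial R] {g : R[X]} (hg : g.Monic)
    (hdeg : g.natDegree ≠ 0) (n : ℕ) (a c : R) :
    (g ^ n + C c * ∑ i ∈ Finset.Icc 1 n, (C a * g) ^ (n - i)).Monic := by
  refine (hg.pow n).add_of_left ?_
  rw [degree_eq_natDegree (hg.pow n).ne_zero, hg.natDegree_pow, Finset.mul_sum]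
  refine lt_of_le_of_lt (degree_sum_le _ _) ((Finset.sup_lt_iff (WithBot.bot_lt_coe _)).2 ?_)
  intro i hi
  rw [Finset.mem_Icc] at hi
  have hle : (C c * (C a * g) ^ (n - i)).natDegree ≤ (n - i) * g.natDegree :=
    (natDegree_C_mul_le _ _).trans (natDegree_pow_le_of_le _ (natDegree_C_mul_le _ _))
  refine lt_of_le_of_lt (degree_le_of_natDegree_le hle) ?_
  exact_mod_cast Nat.mul_lt_mul_of_pos_right (by omega) (Nat.pos_of_ne_zero hdeg)

end Polynomial

namespace NumberField.RingOfIntegers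

variable {K : Type*} [Field K] [NumberField K] {θ : 𝓞 K}

theorem dvd_of_aeval_eq_zero {F : ℤ[X]} (hF : F.Monic)
    (hirr : Irreducible (F.map (algebraMap ℤ ℚ))) (hθ : aeval θ F = 0) {Z : ℤ[X]}
    (hZ : aeval θ Z = 0) : F ∣ Z := by
  have key : ∀ P : ℤ[X], aeval θ P = 0 → aeval (θ : K) (P.map (algebraMap ℤ ℚ)) = 0 := by
    intro P hP
    rw [aeval_map_algebraMap, ← map_zero (algebraMap (𝓞 K) K), ← hP, ← aeval_algebraMap_apply]
  rw [← map_dvd_map (algebraMap ℤ ℚ) (algebraMap ℤ ℚ).injective_int hF,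
    minpoly.eq_of_irreducible_of_monic hirr (key F hθ) (hF.map _)]
  exact minpoly.dvd ℚ _ (key Z hZ)

theorem exists_zsmul_mem_adjoin (hgen : Algebra.adjoin ℚ {(θ : K)} = ⊤) (y : 𝓞 K) :
    ∃ d : ℤ, d ≠ 0 ∧ d • y ∈ Algebra.adjoin ℤ {θ} := by
  have hy : (y : K) ∈ Algebra.adjoin ℚ {(θ : K)} := hgen ▸ Algebra.mem_top
  rw [Algebra.adjoin_singleton_eq_range_aeval] at hy
  obtain ⟨q, hq⟩ := hy
  obtain ⟨d, hd0, hd⟩ := IsLocalization.integerNormalization_spec (nonZeroDivisors ℤ) q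
  refine ⟨d, nonZeroDivisors.ne_zero hd0, ?_⟩
  have : d • y = aeval θ (IsLocalization.integerNormalization (nonZeroDivisors ℤ) q) := by
    apply RingOfIntegers.coe_injective
    rw [← aeval_algebraMap_apply, ← aeval_map_algebraMap ℚ, hd]
    simp only [map_zsmul]
    exact congrArg _ hq.symm
  rw [this]
  exact aeval_mem_adjoin_singleton ℤ θ

theorem finite_quotient_adjoin (hgen : Algebra.adjoin ℚ {(θ : K)} = ⊤) :
    Finite (𝓞 K ⧸ (Algebra.adjoin ℤ {θ}).toSubring.toAddSubgroup) := by
  have : AddGroup.FG (𝓞 K) := Module.Finite.iff_addGroup_fg.1 inferInstance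
  have : AddGroup.FG (𝓞 K ⧸ (Algebra.adjoin ℤ {θ}).toSubring.toAddSubgroup) :=
    AddGroup.fg_of_surjective (QuotientAddGroup.mk'_surjective _)
  refine AddCommGroup.finite_of_fg_isAddTorsion _ fun x => ?_
  obtain ⟨y, rfl⟩ := QuotientAddGroup.mk_surjective x
  obtain ⟨d, hd0, hd⟩ := exists_zsmul_mem_adjoin hgen y
  refine isOfFinAddOrder_iff_zsmul_eq_zero.2 ⟨d, hd0, ?_⟩
  rw [← QuotientAddGroup.mk_zsmul]
  exact (QuotientAddGroup.eq_zero_iff _).2 hd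

theorem dvd_index_adjoin_iff (hgen : Algebra.adjoin ℚ {(θ : K)} = ⊤) {p : ℕ} (hp : p.Prime) :
    p ∣ (Algebra.adjoin ℤ {θ}).toSubring.toAddSubgroup.index ↔
      ∃ y : 𝓞 K, y ∉ Algebra.adjoin ℤ {θ} ∧ (p : 𝓞 K) * y ∈ Algebra.adjoin ℤ {θ} := by
  have := finite_quotient_adjoin hgen
  have hmem : ∀ y : 𝓞 K, (QuotientAddGroup.mk y :
      𝓞 K ⧸ (Algebra.adjoin ℤ {θ}).toSubring.toAddSubgroup) = 0 ↔ y ∈ Algebra.adjoin ℤ {θ} :=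
    fun y => QuotientAddGroup.eq_zero_iff y
  have := Fact.mk hp
  rw [AddSubgroup.index]
  constructor
  · intro hdvd
    obtain ⟨x, hx⟩ := exists_prime_addOrderOf_dvd_card' p hdvd
    obtain ⟨y, rfl⟩ := QuotientAddGroup.mk_surjective x
    refine ⟨y, fun hy => ?_, ?_⟩
    · rw [(hmem y).2 hy, addOrderOf_zero] at hx
      exact hp.one_lt.ne hx
    · rw [← hmem, ← nsmul_eq_mul, QuotientAddGroup.mk_nsmul, ← hx, addOrderOf_nsmul_eq_zero]
  · rintro ⟨y, hy, hpy⟩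
    rw [← hmem, ← nsmul_eq_mul, QuotientAddGroup.mk_nsmul] at hpy
    rw [← hmem] at hy
    rw [← addOrderOf_eq_prime hpy hy]
    exact addOrderOf_dvd_natCard _

/-- If `g` is irreducible modulo `p` and divides `F` modulo `p`, some maximal ideal contains both
`p` and the value of `g` at a root `θ` of `F`. -/
theorem exists_isMaximal_mem_of_irreducible {F : ℤ[X]} (hF : ∀ Z : ℤ[X], aeval θ Z = 0 → F ∣ Z)
    {p : ℕ} [Fact p.Prime] {g : ℤ[X]} (hg : Irreducible (g.map (Int.castRingHom (ZMod p))))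
    (hgF : g.map (Int.castRingHom (ZMod p)) ∣ F.map (Int.castRingHom (ZMod p))) :
    ∃ P : Ideal (𝓞 K), P.IsMaximal ∧ (p : 𝓞 K) ∈ P ∧ aeval θ g ∈ P := by
  have : (Ideal.span {g.map (Int.castRingHom (ZMod p))}).IsMaximal :=
    PrincipalIdealRing.isMaximal_of_irreducible hg
  let φ : ℤ[X] →+* (ZMod p)[X] := Polynomial.mapRingHom (Int.castRingHom (ZMod p))
  let I : Ideal ℤ[X] := (Ideal.span {g.map (Int.castRingHom (ZMod p))}).comap φ
  have hI : I.IsMaximal :=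
    Ideal.comap_isMaximal_of_surjective φ (map_intCast_zmod_surjective p)
  let : Algebra ℤ[X] (𝓞 K) := (aeval θ : ℤ[X] →ₐ[ℤ] 𝓞 K).toRingHom.toAlgebra
  have halg : ∀ Z : ℤ[X], algebraMap ℤ[X] (𝓞 K) Z = aeval θ Z := fun _ => rfl
  have : IsScalarTower ℤ ℤ[X] (𝓞 K) := IsScalarTower.of_algebraMap_eq' (RingHom.ext_int _ _)
  have : Algebra.IsIntegral ℤ[X] (𝓞 K) := Algebra.IsIntegral.tower_top ℤ
  obtain ⟨P, hP, hPI⟩ := Ideal.exists_ideal_over_maximal_of_isIntegral (S := 𝓞 K) I (by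
    intro Z hZ
    rw [RingHom.mem_ker, halg] at hZ
    exact Ideal.mem_span_singleton.2 (hgF.trans (Polynomial.map_dvd _ (hF Z hZ))))
  refine ⟨P, hP, ?_, ?_⟩
  · have : C (p : ℤ) ∈ I := by simp [I, φ, Ideal.mem_comap]
    rw [← hPI, Ideal.mem_comap, halg] at this
    simpa using this
  · have : g ∈ I := Ideal.mem_span_singleton.2 dvd_rfl
    rwa [← hPI, Ideal.mem_comap, halg] at this

/-- **Dedekind's criterion** for a monic polynomial `F` which is congruent modulo `p` to a power
`h ^ m` with `2 ≤ m`. Here `h` need not be squarefree modulo `p`. -/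
theorem not_dvd_index_adjoin_iff_isCoprime {F h M : ℤ[X]} (hFm : F.Monic) (hhm : h.Monic)
    (hirr : Irreducible (F.map (algebraMap ℤ ℚ))) (hθ : aeval θ F = 0)
    (hgen : Algebra.adjoin ℚ {(θ : K)} = ⊤) {p m : ℕ} (hp : p.Prime) (hm : 2 ≤ m)
    (hM : C (p : ℤ) * M = F - h ^ m) :
    (¬ p ∣ (Algebra.adjoin ℤ {θ}).toSubring.toAddSubgroup.index) ↔
      IsCoprime (M.map (Int.castRingHom (ZMod p))) (h.map (Int.castRingHom (ZMod p))) := by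
  have := Fact.mk hp
  obtain ⟨l, rfl⟩ := Nat.exists_eq_add_of_le' hm
  have hpoly : ∀ Z : ℤ[X], aeval θ Z = 0 → F ∣ Z := fun Z => dvd_of_aeval_eq_zero hFm hirr hθ
  have hp0 : (p : 𝓞 K) ≠ 0 := Nat.cast_ne_zero.2 hp.ne_zero
  have hCp : (C (p : ℤ)).map (Int.castRingHom (ZMod p)) = 0 := by simp
  have hCθ : aeval θ (C (p : ℤ)) = (p : 𝓞 K) := by simp
  have hbar : F.map (Int.castRingHom (ZMod p)) = h.map (Int.castRingHom (ZMod p)) ^ (l + 2) := by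
    have := congrArg (Polynomial.map (Int.castRingHom (ZMod p))) hM
    rw [Polynomial.map_mul, hCp, zero_mul, Polynomial.map_sub, Polynomial.map_pow] at this
    exact (sub_eq_zero.1 this.symm)
  have hh0 : h.map (Int.castRingHom (ZMod p)) ≠ 0 := (hhm.map _).ne_zero
  have hMθ : aeval θ h ^ (l + 2) = -(p * aeval θ M) := by
    have := congrArg (aeval θ) hM
    simp only [map_mul, map_sub, map_pow, hθ, zero_sub, hCθ] at this
    rw [this, neg_neg]
  have lift := map_intCast_zmod_surjective p
  -- the factor `h ^ (l + 1) * q` complementary to `g` takes at `θ` a value almost divisible by `p`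
  have hQ : ∀ g q r : ℤ[X], h = g * q + C (p : ℤ) * r →
      aeval θ h = aeval θ g * aeval θ q + p * aeval θ r ∧
      aeval θ (h ^ (l + 1) * q) * aeval θ g =
        p * -(aeval θ M + aeval θ r * aeval θ h ^ (l + 1)) := by
    intro g q r hr
    have hrθ : aeval θ h = aeval θ g * aeval θ q + p * aeval θ r := by
      have := congrArg (aeval θ) hr
      simpa only [map_mul, map_add, hCθ] using this
    refine ⟨hrθ, ?_⟩
    rw [map_mul, map_pow]
    linear_combination hMθ - aeval θ h ^ (l + 1) * hrθ
  rw [dvd_index_adjoin_iff hgen hp]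
  constructor
  · intro hind
    by_contra hcop
    obtain ⟨gb, hgb, hgM, hgh⟩ : ∃ gb : (ZMod p)[X], Irreducible gb ∧
        gb ∣ M.map (Int.castRingHom (ZMod p)) ∧ gb ∣ h.map (Int.castRingHom (ZMod p)) := by
      by_contra! hno
      exact hcop (isCoprime_of_irreducible_dvd (fun H => hh0 H.2) hno)
    obtain ⟨g, rfl⟩ := lift gb
    obtain ⟨qb, hqb⟩ := hgh
    obtain ⟨sb, hsb⟩ := hgM
    obtain ⟨q, rfl⟩ := lift qb
    obtain ⟨s, rfl⟩ := lift sb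
    simp only [← Polynomial.map_mul] at hqb hsb
    obtain ⟨r, hr⟩ := exists_eq_add_C_mul_of_map_intCast_zmod_eq hqb
    obtain ⟨t, ht⟩ := exists_eq_add_C_mul_of_map_intCast_zmod_eq hsb
    obtain ⟨hrθ, hQg⟩ := hQ g q r hr
    have htθ : aeval θ M = aeval θ g * aeval θ s + p * aeval θ t := by
      have := congrArg (aeval θ) ht
      simpa only [map_mul, map_add, hCθ] using this
    have hdvd : (p : 𝓞 K) ∣ aeval θ (h ^ (l + 1) * q) := by
      let I : Ideal (𝓞 K) := Ideal.span {(p : 𝓞 K), aeval θ g}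
      have hpI : (p : 𝓞 K) ∈ I := Ideal.subset_span (by simp)
      have hgI : aeval θ g ∈ I := Ideal.subset_span (by simp)
      have hI0 : I ≠ 0 := fun H => hp0 (by rw [H] at hpI; exact hpI)
      have hhI : aeval θ h ∈ I := by
        rw [hrθ]
        exact I.add_mem (I.mul_mem_right _ hgI) (I.mul_mem_right _ hpI)
      have hMI : aeval θ M ∈ I := by
        rw [htθ]
        exact I.add_mem (I.mul_mem_right _ hgI) (I.mul_mem_right _ hpI)
      rw [← Ideal.span_singleton_le_span_singleton, ← Ideal.dvd_iff_le,
        ← mul_dvd_mul_iff_right hI0, Ideal.dvd_iff_le, Ideal.span_singleton_mul_le_iff]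
      intro z hz
      rw [Ideal.mem_span_pair] at hz
      obtain ⟨u, v, rfl⟩ := hz
      have hpQ : aeval θ (h ^ (l + 1) * q) ∈ I := by
        rw [map_mul, map_pow]
        exact I.mul_mem_right _ (I.pow_mem_of_mem hhI _ (by omega))
      rw [Ideal.mem_span_singleton_mul]
      refine ⟨u * aeval θ (h ^ (l + 1) * q) +
        v * -(aeval θ M + aeval θ r * aeval θ h ^ (l + 1)), ?_, ?_⟩
      · exact I.add_mem (I.mul_mem_left _ hpQ) (I.mul_mem_left _ (I.neg_mem (I.add_mem hMI
          (I.mul_mem_left _ (I.pow_mem_of_mem hhI _ (by omega))))))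
      · linear_combination -v * hQg
    obtain ⟨y, hy⟩ := hdvd
    refine hind ⟨y, fun hyR => ?_, hy ▸ aeval_mem_adjoin_singleton ℤ θ⟩
    rw [Algebra.adjoin_singleton_eq_range_aeval] at hyR
    obtain ⟨Z, rfl⟩ := hyR
    have hFdvd := Polynomial.map_dvd (Int.castRingHom (ZMod p))
      (hpoly (h ^ (l + 1) * q - C (p : ℤ) * Z) (by
        rw [map_sub, hy, map_mul (aeval θ) (C _)]
        simp))
    rw [Polynomial.map_sub, Polynomial.map_mul (p := C _), hCp, zero_mul, sub_zero, hbar,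
      Polynomial.map_mul, Polynomial.map_pow] at hFdvd
    rw [Polynomial.map_mul] at hqb
    have hq0 : q.map (Int.castRingHom (ZMod p)) ≠ 0 := by
      intro H
      rw [H, mul_zero] at hqb
      exact hh0 hqb
    rw [pow_succ, mul_dvd_mul_iff_left (pow_ne_zero _ hh0), hqb] at hFdvd
    exact hgb.not_isUnit (isUnit_of_dvd_one
      ((mul_dvd_mul_iff_right hq0).1 (by rwa [one_mul])))
  · rintro hcop ⟨y, hyR, hpy⟩
    rw [Algebra.adjoin_singleton_eq_range_aeval] at hpy
    obtain ⟨Z, hZ⟩ := hpy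
    replace hZ : aeval θ Z = p * y := hZ
    by_cases hFZ : F.map (Int.castRingHom (ZMod p)) ∣ Z.map (Int.castRingHom (ZMod p))
    · obtain ⟨Ub, hU⟩ := hFZ
      obtain ⟨U, rfl⟩ := lift Ub
      simp only [← Polynomial.map_mul] at hU
      obtain ⟨W, hW⟩ := exists_eq_add_C_mul_of_map_intCast_zmod_eq hU
      refine hyR ?_
      have : y = aeval θ W := by
        refine mul_left_cancel₀ hp0 ?_
        rw [← hZ, hW]
        simp [hθ]
      rw [this]
      exact aeval_mem_adjoin_singleton ℤ θ
    obtain ⟨gb, Qb, hgb, hFQ, ub, vb, hQb⟩ : ∃ gb Qb : (ZMod p)[X], Irreducible gb ∧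
        F.map (Int.castRingHom (ZMod p)) = gb * Qb ∧
        ∃ ub vb, Qb = ub * F.map (Int.castRingHom (ZMod p)) +
          vb * Z.map (Int.castRingHom (ZMod p)) := by
      have hF0 : F.map (Int.castRingHom (ZMod p)) ≠ 0 := (hFm.map _).ne_zero
      generalize F.map (Int.castRingHom (ZMod p)) = f at *
      generalize Z.map (Int.castRingHom (ZMod p)) = z at *
      obtain ⟨E, hE⟩ := EuclideanDomain.gcd_dvd_left f z
      have hEu : ¬ IsUnit E := fun hu => hFZ
        ((hE.dvd.trans (hu.mul_right_dvd.2 dvd_rfl)).trans (EuclideanDomain.gcd_dvd_right f z))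
      have hE0 : E ≠ 0 := fun H => hF0 (by rw [hE, H, mul_zero])
      obtain ⟨gb, hgb, E', rfl⟩ := WfDvdMonoid.exists_irreducible_factor hEu hE0
      refine ⟨gb, EuclideanDomain.gcd f z * E', hgb, by rw [mul_left_comm, ← hE],
        E' * EuclideanDomain.gcdA f z, E' * EuclideanDomain.gcdB f z, ?_⟩
      conv_lhs => rw [EuclideanDomain.gcd_eq_gcd_ab f z]
      ring
    obtain ⟨g, rfl⟩ := lift gb
    obtain ⟨u, rfl⟩ := lift ub
    obtain ⟨v, rfl⟩ := lift vb
    dsimp only at *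
    have hgF : g.map (Int.castRingHom (ZMod p)) ∣ F.map (Int.castRingHom (ZMod p)) :=
      ⟨_, hFQ⟩
    obtain ⟨qb, hqb⟩ := hgb.prime.dvd_of_dvd_pow (hbar ▸ hgF)
    obtain ⟨q, rfl⟩ := lift qb
    dsimp only at hqb
    have hQq : Qb = (h ^ (l + 1) * q).map (Int.castRingHom (ZMod p)) := by
      refine mul_left_cancel₀ hgb.ne_zero ?_
      rw [← hFQ, hbar, Polynomial.map_mul, Polynomial.map_pow]
      linear_combination h.map (Int.castRingHom (ZMod p)) ^ (l + 1) * hqb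
    rw [hQq] at hQb
    simp only [← Polynomial.map_mul, ← Polynomial.map_add] at hQb hqb
    obtain ⟨w, hw⟩ := exists_eq_add_C_mul_of_map_intCast_zmod_eq hQb
    obtain ⟨r, hr⟩ := exists_eq_add_C_mul_of_map_intCast_zmod_eq hqb
    obtain ⟨hrθ, hQg⟩ := hQ g q r hr
    obtain ⟨P, hPmax, hpP, hgP⟩ := exists_isMaximal_mem_of_irreducible hpoly hgb hgF
    have hwθ : aeval θ (h ^ (l + 1) * q) = p * (aeval θ v * y + aeval θ w) := by
      rw [hw]
      simp only [map_mul, map_add, hCθ, hθ,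
        hZ]
      ring
    have hhP : aeval θ h ∈ P := by
      rw [hrθ]
      exact P.add_mem (P.mul_mem_right _ hgP) (P.mul_mem_right _ hpP)
    have hMP : aeval θ M ∈ P := by
      have heq : aeval θ M =
          -((aeval θ v * y + aeval θ w) * aeval θ g + aeval θ r * aeval θ h ^ (l + 1)) := by
        refine mul_left_cancel₀ hp0 ?_
        linear_combination hQg - aeval θ g * hwθ
      rw [heq]
      exact P.neg_mem (P.add_mem (P.mul_mem_left _ hgP)
        (P.mul_mem_left _ (P.pow_mem_of_mem hhP _ (by omega))))
    obtain ⟨Ab, Bb, hAB⟩ := hcop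
    obtain ⟨A, rfl⟩ := lift Ab
    obtain ⟨B, rfl⟩ := lift Bb
    dsimp only at hAB
    rw [← Polynomial.map_mul, ← Polynomial.map_mul, ← Polynomial.map_add,
      ← Polynomial.map_one (Int.castRingHom (ZMod p))] at hAB
    obtain ⟨e, he⟩ := exists_eq_add_C_mul_of_map_intCast_zmod_eq hAB
    have heθ : (1 : 𝓞 K) = aeval θ A * aeval θ M + aeval θ B * aeval θ h - p * aeval θ e := by
      have := congrArg (aeval θ) he
      simp only [map_mul, map_add, map_one, hCθ] at this
      rw [this]
      ring
    refine hPmax.ne_top ((Ideal.eq_top_iff_one P).2 ?_)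
    rw [heθ]
    exact P.sub_mem (P.add_mem (P.mul_mem_left _ hMP) (P.mul_mem_left _ hhP))
      (P.mul_mem_right _ hpP)

end NumberField.RingOfIntegers

theorem stmt_4
    (n k : ℕ) (hn : 3 ≤ n) (hk : 1 ≤ k) (a b c : ℤ)
    (F : Polynomial ℤ)
    (hF : F = (X ^ k + C b) ^ n +
        C c * ∑ i ∈ Finset.Icc 1 n, (C a * (X ^ k + C b)) ^ (n - i))
    (hFdeg : F.natDegree = n * k)
    (hFirr : Irreducible (F.map (algebraMap ℤ ℚ)))
    (K : Type*) [Field K] [NumberField K]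
    (θ : NumberField.RingOfIntegers K)
    (hθ : aeval θ F = 0)
    (hgen : Algebra.adjoin ℚ {(θ : K)} = ⊤)
    (D : ℤ) (hD : IsDiscriminant F D)
    (p : ℕ) (hp : p.Prime) (hpD : (p : ℤ) ∣ D)
    (hpc : ¬ (p : ℤ) ∣ c) (hpk : p ∣ k)
    (j s' : ℕ) (hks : k = p ^ j * s') (hps' : ¬ p ∣ s')
    (h : Polynomial ℤ)
    (hh : h = (X ^ s' + C b) ^ n +
        C c * ∑ i ∈ Finset.Icc 1 n, (C a * (X ^ s' + C b)) ^ (n - i))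
    (M : Polynomial ℤ) (hM : C (p : ℤ) * M = F - h ^ p ^ j) :
    (¬ p ∣ (Algebra.adjoin ℤ {θ}).toSubring.toAddSubgroup.index) ↔
      IsCoprime (M.map (Int.castRingHom (ZMod p)))
        (h.map (Int.castRingHom (ZMod p))) := by
  have hs : s' ≠ 0 := fun H => hps' (H ▸ dvd_zero p)
  have hj : j ≠ 0 := by
    rintro rfl
    exact hps' (by simpa [hks] using hpk)
  have monic_comp : ∀ l : ℕ, l ≠ 0 → ((X ^ l + C b) ^ n +
      C c * ∑ i ∈ Finset.Icc 1 n, (C a * (X ^ l + C b)) ^ (n - i)).Monic := fun l hl =>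
    (monic_X_pow_add_C b hl).pow_add_C_mul_sum (by rwa [natDegree_X_pow_add_C]) n a c
  exact NumberField.RingOfIntegers.not_dvd_index_adjoin_iff_isCoprime
    (hF ▸ monic_comp k (by omega)) (hh ▸ monic_comp s' hs) hFirr hθ hgen hp
    (hp.two_le.trans (Nat.le_self_pow hj p)) hM
end

section
/- Let F(x) = (x^k + b)^n + c·∑_{i=1}^{n} (a(x^k + b))^{n-i} ∈ ℤ[x] be irreducible of degree nk over ℚ, let θ be a root of F, and K = ℚ(θ). Let p be a prime divisor of the discriminant 𝔇_F with p ∤ ck, p ∣ an and p ∤ gcd(a, n). Then p does not divide the index [ℤ_K : ℤ[θ]] if and only if (k ≥ 2 implies p² ∤ f_1(b)). -/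
open Polynomial

/-- The polynomial `x^n + c ∑_{i<n} (a x)^i` is coprime to its derivative over a field in which
`c ≠ 0` and exactly one of `a`, `n` vanishes. -/
theorem isCoprime_derivative_X_pow_add_geom_sum {E : Type*} [Field E] (a c : E) (hc : c ≠ 0)
    (n : ℕ) (hn : n ≠ 0) (h : a = 0 ∧ (n : E) ≠ 0 ∨ a ≠ 0 ∧ (n : E) = 0) :
    IsCoprime (X ^ n + C c * ∑ i ∈ Finset.range n, (C a * X) ^ i)
      (derivative (X ^ n + C c * ∑ i ∈ Finset.range n, (C a * X) ^ i)) := by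
  obtain ⟨m, rfl⟩ : ∃ m, n = m + 1 := ⟨n - 1, by omega⟩
  set f : E[X] := X ^ (m + 1) + C c * ∑ i ∈ Finset.range (m + 1), (C a * X) ^ i with hf
  have hX : IsCoprime f X := by
    obtain ⟨r, hr⟩ : ∃ r, f = C c + X * r := by
      refine ⟨X ^ m + C c * (C a * ∑ i ∈ Finset.range m, (C a * X) ^ i), ?_⟩
      rw [hf, Finset.sum_range_succ', pow_zero]
      simp only [pow_succ (C a * X), ← Finset.sum_mul]
      ring
    rw [hr]
    apply IsCoprime.add_mul_left_left
    exact ⟨C c⁻¹, 0, by rw [← C_mul, inv_mul_cancel₀ hc]; simp⟩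
  rcases h with ⟨rfl, hn0⟩ | ⟨ha, hn0⟩
  · have hf' : f = X ^ (m + 1) + C c := by
      rw [hf, Finset.sum_range_succ']; simp
    have hd : derivative f = C ((m + 1 : ℕ) : E) * X ^ m := by
      rw [hf']; simp
    rw [hd]
    exact (isCoprime_mul_unit_left_right (isUnit_C.2 hn0.isUnit) _ _).2 hX.pow_right
  · have hg : (C a * X - 1) * f =
        (C a * X - 1) * X ^ (m + 1) + C c * ((C a * X) ^ (m + 1) - 1) := by
      rw [← geom_sum_mul, hf]; ring
    have hn1 : C ((m + 1 : ℕ) : E) = 0 := by rw [hn0, C_0]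
    have hn2 : C (m : E) + 1 = 0 := by simpa using hn1
    have hd := congrArg derivative hg
    simp only [derivative_mul, derivative_add, derivative_sub, derivative_C, derivative_X,
      derivative_one, derivative_pow, Nat.add_sub_cancel, zero_mul, zero_add, mul_one,
      sub_zero, hn1] at hd
    simp only [mul_zero, add_zero] at hd
    have key : IsCoprime f (C a * X ^ (m + 1)) :=
      (isCoprime_mul_unit_left_right (isUnit_C.2 ha.isUnit) _ _).2 hX.pow_right
    rw [← hd, add_comm] at key
    rw [mul_comm (C a) f] at key
    exact key.of_add_mul_left_right.of_mul_right_right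

section

variable {O : Type*} [CommRing O] {θ : O} {F : ℤ[X]} {p : ℕ}

theorem zmod_map_eq_zero_iff {g : ℤ[X]} :
    g.map (Int.castRingHom (ZMod p)) = 0 ↔ ∃ r : ℤ[X], g = C (p : ℤ) * r := by
  change _ ↔ C (p : ℤ) ∣ g
  rw [C_dvd_iff_dvd_coeff, Polynomial.ext_iff]
  simp [CharP.intCast_eq_zero_iff (ZMod p) p]

theorem zmod_map_dvd_map_iff {g : ℤ[X]} (hF : ∀ g : ℤ[X], aeval θ g = 0 ↔ F ∣ g) :
    F.map (Int.castRingHom (ZMod p)) ∣ g.map (Int.castRingHom (ZMod p)) ↔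
      ∃ r : ℤ[X], aeval θ g = p * aeval θ r := by
  constructor
  · rintro ⟨q, hq⟩
    obtain ⟨q, rfl⟩ := map_surjective _ (ZMod.ringHom_surjective (Int.castRingHom (ZMod p))) q
    rw [← Polynomial.map_mul, ← sub_eq_zero, ← Polynomial.map_sub, zmod_map_eq_zero_iff] at hq
    obtain ⟨r, hr⟩ := hq
    refine ⟨r, ?_⟩
    have := congrArg (aeval θ) hr
    simpa [(hF F).2 dvd_rfl] using this
  · rintro ⟨r, hr⟩
    obtain ⟨q, hq⟩ := (hF (g - C (p : ℤ) * r)).1 (by simp [hr])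
    refine ⟨q.map (Int.castRingHom (ZMod p)), ?_⟩
    rw [← Polynomial.map_mul, ← hq]
    simp

/-- If `p ∣ g(θ)` for an integral extension then the reduction of `F` divides a power of the
reduction of `g`. -/
theorem zmod_map_dvd_map_pow [Algebra.IsIntegral ℤ O] {g : ℤ[X]}
    (hF : ∀ g : ℤ[X], aeval θ g = 0 ↔ F ∣ g) (h : (p : O) ∣ aeval θ g) :
    ∃ M : ℕ, F.map (Int.castRingHom (ZMod p)) ∣ g.map (Int.castRingHom (ZMod p)) ^ M := by
  obtain ⟨α, hα⟩ := h
  obtain ⟨P, hP, hPα⟩ := Algebra.IsIntegral.isIntegral (R := ℤ) α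
  have h0 := scaleRoots_aeval_eq_zero (r := (p : ℤ)) (show aeval α P = 0 from hPα)
  rw [show algebraMap ℤ O (p : ℤ) * α = aeval θ g by simp [hα], ← aeval_comp, hF] at h0
  refine ⟨P.natDegree, ?_⟩
  have h1 := Polynomial.map_dvd (Int.castRingHom (ZMod p)) h0
  rw [Polynomial.map_comp] at h1
  by_cases hp1 : p = 1
  · subst hp1
    exact ⟨0, Subsingleton.elim _ _⟩
  have : Nontrivial (ZMod p) := ZMod.nontrivial_iff.2 hp1
  rw [map_scaleRoots _ _ _ (by simp [hP.leadingCoeff])] at h1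
  simpa [scaleRoots_zero, (hP.map (Int.castRingHom (ZMod p))).leadingCoeff,
    hP.natDegree_map] using h1

theorem dvd_aeval_of_zmod_map_eq {g g' : ℤ[X]}
    (h : g.map (Int.castRingHom (ZMod p)) = g'.map (Int.castRingHom (ZMod p)))
    (hg : (p : O) ∣ aeval θ g) : (p : O) ∣ aeval θ g' := by
  rw [← sub_eq_zero, ← Polynomial.map_sub, zmod_map_eq_zero_iff] at h
  obtain ⟨r, hr⟩ := h
  have hr' := congrArg (aeval θ) hr
  simp only [map_sub, map_mul, aeval_C] at hr'
  have : aeval θ g' = aeval θ g - p * aeval θ r := by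
    rw [sub_eq_iff_eq_add] at hr'
    rw [hr']
    simp
  rw [this]
  exact dvd_sub hg (dvd_mul_right _ _)

theorem comp_X_pow_add_C_eq (f : ℤ[X]) (k : ℕ) (b : ℤ) :
    f.comp (X ^ k + C b) =
      X ^ k * ((taylor b f).divX.comp (X ^ k)) + C (f.eval b) := by
  have h := congrArg (fun g => g.comp (X ^ k)) (divX_mul_X_add (taylor b f))
  simp only [taylor_coeff_zero, add_comp, mul_comp, X_comp, C_comp] at h
  rw [mul_comm, h, taylor_apply, comp_assoc]
  simp

/-- The easy half: if `k ≥ 2` and `p² ∣ f(b)` then `ℤ[θ]` is not `p`-maximal. -/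
theorem exists_smul_mem_of_sq_dvd [IsDomain O] [IsIntegrallyClosed O] {f : ℤ[X]} (hf : f.Monic) (hp : p.Prime) {k : ℕ} (hk : 2 ≤ k)
    {b : ℤ} (hF : ∀ g : ℤ[X], aeval θ g = 0 ↔ f.comp (X ^ k + C b) ∣ g)
    (h2 : (p : ℤ) ^ 2 ∣ f.eval b) :
    ∃ α : O, α ∉ Algebra.adjoin ℤ {θ} ∧ p * α ∈ Algebra.adjoin ℤ {θ} := by
  have : Fact p.Prime := ⟨hp⟩
  obtain ⟨l, rfl⟩ : ∃ l, k = l + 2 := ⟨k - 2, by omega⟩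
  set φ := Int.castRingHom (ZMod p) with hφ
  set F := f.comp (X ^ (l + 2) + C b) with hFdef
  set G := (taylor b f).divX.comp (X ^ (l + 2)) with hG
  have hFG : F = X ^ (l + 2) * G + C (f.eval b) := comp_X_pow_add_C_eq f (l + 2) b
  have hFmon : F.Monic := hf.comp (monic_X_pow_add_C b (by omega)) (by
    rw [natDegree_X_pow_add_C]; omega)
  have hF0 : F.map φ ≠ 0 := (hFmon.map φ).ne_zero
  obtain ⟨m, hm⟩ := h2
  have hFθ := (hF F).2 dvd_rfl
  rw [hFG, hm] at hFθ
  simp only [map_add, map_mul, map_pow, aeval_X, aeval_C] at hFθ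
  have hdvd : (p : O) ^ 2 ∣ (θ ^ (l + 1) * aeval θ G) ^ 2 := by
    refine ⟨-m * (θ ^ l * aeval θ G), ?_⟩
    simp at hFθ
    linear_combination (θ ^ l * aeval θ G) * hFθ
  obtain ⟨α, hα⟩ := (IsIntegrallyClosed.pow_dvd_pow_iff two_ne_zero).1 hdvd
  have hα' : aeval θ (X ^ (l + 1) * G) = p * α := by simpa using hα
  rw [Algebra.adjoin_singleton_eq_range_aeval]
  refine ⟨α, ?_, ⟨_, hα'⟩⟩
  rintro ⟨r, rfl⟩
  have h3 := (zmod_map_dvd_map_iff hF).2 ⟨r, hα'⟩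
  have hb0 : φ (f.eval b) = 0 := by
    rw [hm]; simp [hφ]
  have hFG' : F.map φ = (X ^ (l + 1) * G).map φ * X := by
    rw [hFG, Polynomial.map_add, map_C, hb0, C_0, add_zero]
    simp only [Polynomial.map_mul, Polynomial.map_pow, map_X]
    ring
  rw [← hφ, hFG'] at h3
  have h4 : X ∣ (1 : (ZMod p)[X]) := by
    refine (mul_dvd_mul_iff_left (a := (X ^ (l + 1) * G).map φ) ?_).1 (by rwa [mul_one])
    intro h0
    exact hF0 (by rw [hFG', h0, zero_mul])
  exact not_isUnit_X (isUnit_of_dvd_one h4)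

set_option maxHeartbeats 400000 in
/-- Suppose `f` is separable modulo `p` and `p ∤ k`. If `ℤ[θ]` is not `p`-maximal, then `k ≥ 2`
and `p² ∣ f(b)`. -/
theorem sq_dvd_of_not_maximal [IsDomain O] [CharZero O] [Algebra.IsIntegral ℤ O] {f : ℤ[X]} (hf : f.Monic) (hp : p.Prime)
    {k : ℕ} (hk : ¬ p ∣ k) {b : ℤ}
    (hF : ∀ g : ℤ[X], aeval θ g = 0 ↔ f.comp (X ^ k + C b) ∣ g)
    (hsep : IsCoprime (f.map (Int.castRingHom (ZMod p)))
      (derivative (f.map (Int.castRingHom (ZMod p)))))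
    {α : O} (hα : α ∉ Algebra.adjoin ℤ {θ}) (hpα : p * α ∈ Algebra.adjoin ℤ {θ}) :
    2 ≤ k ∧ (p : ℤ) ^ 2 ∣ f.eval b := by
  have : Fact p.Prime := ⟨hp⟩
  have hp0 : (p : O) ≠ 0 := Nat.cast_ne_zero.2 hp.ne_zero
  set φ := Int.castRingHom (ZMod p) with hφ
  have hsurj : Function.Surjective (mapRingHom φ) :=
    map_surjective _ (ZMod.ringHom_surjective φ)
  set F := f.comp (X ^ k + C b) with hFdef
  set G := (taylor b f).divX.comp (X ^ k) with hG
  have hk0 : k ≠ 0 := by rintro rfl; simp at hk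
  have hFG : F = X ^ k * G + C (f.eval b) := comp_X_pow_add_C_eq f k b
  have hFm : F.map φ = (f.map φ).comp (X ^ k + C (φ b)) := by
    simp [hFdef, Polynomial.map_comp]
  have hFmon : F.Monic := hf.comp (monic_X_pow_add_C b hk0) (by
    rw [natDegree_X_pow_add_C]; exact hk0)
  have hF0 : F.map φ ≠ 0 := (hFmon.map φ).ne_zero
  let J : Ideal (ZMod p)[X] :=
    ((Ideal.span {(p : O)}).comap (aeval θ : ℤ[X] →ₐ[ℤ] O)).map (mapRingHom φ)
  have hJ : ∀ g : ℤ[X], g.map φ ∈ J ↔ (p : O) ∣ aeval θ g := by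
    intro g
    rw [Ideal.mem_map_iff_of_surjective _ hsurj]
    simp only [Ideal.mem_comap, Ideal.mem_span_singleton]
    exact ⟨fun ⟨x, hx, hxg⟩ => dvd_aeval_of_zmod_map_eq hxg hx, fun h => ⟨g, h, rfl⟩⟩
  obtain ⟨h, hh⟩ : ∃ h, ∀ g, g ∈ J ↔ h ∣ g :=
    ⟨_, fun g => Submodule.IsPrincipal.mem_iff_generator_dvd J⟩
  have hhF : h ∣ F.map φ := (hh _).1 ((hJ F).2 (by rw [(hF F).2 dvd_rfl]; exact dvd_zero _))
  obtain ⟨w, hw⟩ := hhF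
  have hwu : ¬ IsUnit w := by
    intro hu
    rw [Algebra.adjoin_singleton_eq_range_aeval] at hpα hα
    obtain ⟨g, hg⟩ := hpα
    apply hα
    have h1 : h ∣ g.map φ := (hh _).1 ((hJ g).2 ⟨α, hg⟩)
    have h2 : F.map φ ∣ g.map φ := by
      rw [hw]; exact hu.mul_right_dvd.2 h1
    obtain ⟨r, hr⟩ := (zmod_map_dvd_map_iff hF).1 h2
    exact ⟨r, mul_left_cancel₀ hp0 (hr.symm.trans hg)⟩
  obtain ⟨q, hq, w', rfl⟩ := WfDvdMonoid.exists_irreducible_factor hwu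
    (by rintro rfl; exact hF0 (by simpa using hw))
  have hqF : q ∣ F.map φ := ⟨h * w', by rw [hw]; ring⟩
  have hqh : q ∣ h := by
    obtain ⟨g, hg⟩ := hsurj h
    obtain ⟨M, hM⟩ := zmod_map_dvd_map_pow hF ((hJ g).1 ((hh _).2 (dvd_of_eq hg.symm)))
    have := hq.prime.dvd_of_dvd_pow (hqF.trans hM)
    rwa [show g.map φ = h from hg] at this
  obtain ⟨h', rfl⟩ := hqh
  have hqd : q ∣ derivative (F.map φ) :=
    ⟨derivative q * (h' * w') * 2 + q * derivative (h' * w'), by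
      rw [hw, show q * h' * (q * w') = q ^ 2 * (h' * w') by ring, derivative_mul, derivative_pow]
      simp only [Nat.cast_ofNat, C_ofNat, Nat.add_one_sub_one, pow_one]; ring⟩
  have hcop : IsCoprime (F.map φ) ((derivative (f.map φ)).comp (X ^ k + C (φ b))) := by
    rw [hFm]
    exact hsep.map (compRingHom (X ^ k + C (φ b)))
  have hqn : ¬ q ∣ (derivative (f.map φ)).comp (X ^ k + C (φ b)) := fun hd =>
    hq.not_isUnit (hcop.isUnit_of_dvd' hqF hd)
  have hkp : (k : ZMod p) ≠ 0 := by rwa [Ne, ZMod.natCast_eq_zero_iff]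
  have hqX1 : q ∣ X ^ (k - 1) := by
    rw [hFm, derivative_comp] at hqd
    have h1 := (hq.prime.dvd_or_dvd hqd).resolve_right hqn
    simp only [derivative_add, derivative_X_pow, derivative_C, add_zero] at h1
    exact ((isUnit_C.2 hkp.isUnit).dvd_mul_left).1 h1
  have hk2 : 2 ≤ k := by
    by_contra hlt
    have : k - 1 = 0 := by omega
    rw [this, pow_zero] at hqX1
    exact hq.not_isUnit (isUnit_of_dvd_one hqX1)
  have hqX : q ∣ X := hq.prime.dvd_of_dvd_pow hqX1
  have hXq : X ∣ q := (hq.associated_of_dvd irreducible_X hqX).symm.dvd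
  refine ⟨hk2, ?_⟩
  have hXF : X ∣ F.map φ := hXq.trans hqF
  have hb0 : φ (f.eval b) = 0 := by
    rw [hFG, Polynomial.map_add, Polynomial.map_mul, Polynomial.map_pow, map_X, map_C,
      dvd_add_right ((dvd_pow_self X hk0).mul_right _), X_dvd_iff, coeff_C_zero] at hXF
    exact hXF
  have hFG' : F.map φ = X ^ k * G.map φ := by
    rw [hFG, Polynomial.map_add, map_C, hb0, C_0, add_zero]; simp
  have hXG : ¬ X ∣ G.map φ := by
    intro hd
    have h1 : φ ((derivative f).eval b) = 0 := by
      rw [X_dvd_iff, coeff_map, coeff_zero_eq_eval_zero, hG, eval_comp, eval_pow, eval_X,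
        zero_pow hk0, ← coeff_zero_eq_eval_zero, coeff_divX, zero_add, taylor_coeff_one] at hd
      exact hd
    have h2 := hsep.map (evalRingHom (φ b))
    rw [derivative_map, coe_evalRingHom, eval_map_apply, eval_map_apply, hb0, h1] at h2
    exact not_isCoprime_zero_zero h2
  obtain ⟨m, hm⟩ : (p : ℤ) ∣ f.eval b := by
    rwa [hφ, eq_intCast, ZMod.intCast_zmod_eq_zero_iff_dvd] at hb0
  by_contra hnd
  have hpm : ¬ (p : ℤ) ∣ m := by
    rintro ⟨m', rfl⟩
    exact hnd ⟨m', by rw [hm]; ring⟩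
  have hXG' : X * (X ^ (k - 1) * G).map φ = F.map φ := by
    rw [hFG', Polynomial.map_mul, Polynomial.map_pow, map_X, ← mul_assoc, ← pow_succ',
      Nat.sub_add_cancel (by omega)]
  have hmem : q * h' ∣ (X ^ (k - 1) * G).map φ := by
    obtain ⟨u, hu⟩ := hXq
    refine ⟨u * w', mul_left_cancel₀ (X_ne_zero (R := ZMod p)) ?_⟩
    rw [hXG', hw]
    linear_combination (q * h' * w') * hu
  obtain ⟨β, hβ⟩ := (hJ (X ^ (k - 1) * G)).1 ((hh _).2 hmem)
  have hFθ := (hF F).2 dvd_rfl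
  rw [hFG, hm] at hFθ
  simp only [map_add, map_mul, map_pow, aeval_X, aeval_C] at hFθ hβ
  have hθk : θ ^ k * aeval θ G = - (p * m) := by
    simp at hFθ
    linear_combination hFθ
  have hθβ : θ * β = - m := by
    apply mul_left_cancel₀ hp0
    have hk1 : θ ^ k = θ * θ ^ (k - 1) := by rw [← pow_succ']; congr 1; omega
    rw [hk1] at hθk
    linear_combination hθk - θ * hβ
  have hcopm : IsCoprime (p : O) ((m : O) ^ k) := by
    have := ((Nat.prime_iff_prime_int.1 hp).coprime_iff_not_dvd.2 hpm).map (Int.castRingHom O)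
    simpa using this.pow_right (n := k)
  have hpG : (p : O) ∣ aeval θ G := by
    apply hcopm.dvd_of_dvd_mul_left
    have : (m : O) = - (θ * β) := by rw [hθβ, neg_neg]
    rw [this]
    refine ⟨-(-β) ^ k * m, ?_⟩
    rw [← mul_neg, mul_pow]
    linear_combination (-β) ^ k * hθk
  obtain ⟨M, hM⟩ := zmod_map_dvd_map_pow hF hpG
  exact hXG (prime_X.dvd_of_dvd_pow (hXF.trans hM))

end

/-- A prime divides the index of a subgroup of finite index iff some element outside the subgroup
is brought into it by multiplication by the prime. -/
theorem prime_dvd_index_iff {A : Type*} [AddCommGroup A] (S : AddSubgroup A) [Finite (A ⧸ S)]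
    {p : ℕ} (hp : p.Prime) : p ∣ S.index ↔ ∃ x ∉ S, p • x ∈ S := by
  have : Fact p.Prime := ⟨hp⟩
  rw [AddSubgroup.index]
  constructor
  · intro h
    obtain ⟨x, hx⟩ := exists_prime_addOrderOf_dvd_card' p h
    obtain ⟨x, rfl⟩ := QuotientAddGroup.mk_surjective x
    refine ⟨x, ?_, ?_⟩
    · intro hxS
      rw [(QuotientAddGroup.eq_zero_iff x).2 hxS, addOrderOf_zero] at hx
      exact hp.one_lt.ne hx
    · have := addOrderOf_nsmul_eq_zero (x : A ⧸ S)
      rwa [hx, ← QuotientAddGroup.mk_nsmul, QuotientAddGroup.eq_zero_iff] at this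
  · rintro ⟨x, hx, hpx⟩
    rw [← QuotientAddGroup.eq_zero_iff] at hx hpx
    rw [QuotientAddGroup.mk_nsmul] at hpx
    have h := addOrderOf_dvd_natCard (x : A ⧸ S)
    rwa [addOrderOf_eq_prime hpx hx] at h

/-- The order generated by a primitive integral element has finite index. -/
theorem finite_quotient_adjoin {K : Type*} [Field K] [NumberField K]
    (θ : NumberField.RingOfIntegers K) (hgen : Algebra.adjoin ℚ {(θ : K)} = ⊤) :
    Finite (NumberField.RingOfIntegers K ⧸ (Algebra.adjoin ℤ {θ}).toSubring.toAddSubgroup) := by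
  set S := (Algebra.adjoin ℤ {θ}).toSubring.toAddSubgroup with hS
  have hfg : AddGroup.FG (NumberField.RingOfIntegers K) :=
    AddGroup.fg_iff_addMonoid_fg.2 (Module.Finite.iff_addMonoid_fg.1 inferInstance)
  have : AddGroup.FG (NumberField.RingOfIntegers K ⧸ S) := inferInstance
  apply AddCommGroup.finite_of_fg_isAddTorsion
  intro x
  obtain ⟨x, rfl⟩ := QuotientAddGroup.mk_surjective x
  have hx : (x : K) ∈ Algebra.adjoin ℚ {(θ : K)} := hgen ▸ Algebra.mem_top
  rw [Algebra.adjoin_singleton_eq_range_aeval] at hx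
  obtain ⟨g, hg⟩ := hx
  obtain ⟨d, hd0, hd⟩ := IsLocalization.integerNormalization_spec (nonZeroDivisors ℤ) g
  have hdx : d • x = aeval θ (IsLocalization.integerNormalization (nonZeroDivisors ℤ) g) := by
    apply NumberField.RingOfIntegers.ext
    have h1 := congrArg (aeval (θ : K)) hd
    rw [aeval_map_algebraMap, map_zsmul, show aeval (θ : K) g = x from hg] at h1
    refine (map_zsmul (algebraMap (NumberField.RingOfIntegers K) K) d x).trans (h1.symm.trans ?_)
    exact aeval_algebraMap_apply K θ _
  rw [isOfFinAddOrder_iff_zsmul_eq_zero]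
  refine ⟨d, nonZeroDivisors.ne_zero hd0, ?_⟩
  rw [← QuotientAddGroup.mk_zsmul, QuotientAddGroup.eq_zero_iff, hdx]
  change _ ∈ Algebra.adjoin ℤ {θ}
  rw [Algebra.adjoin_singleton_eq_range_aeval]
  exact ⟨_, rfl⟩

theorem monic_X_pow_add_geom_sum {R : Type*} [CommRing R] (a c : R) (n : ℕ) :
    (X ^ n + C c * ∑ i ∈ Finset.range n, (C a * X) ^ i).Monic := by
  apply monic_X_pow_add
  rw [← mem_degreeLT, ← smul_eq_C_mul]
  refine Submodule.smul_mem _ _ (Submodule.sum_mem _ fun i hi => mem_degreeLT.2 ?_)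
  rw [mul_pow, ← C_pow]
  exact (degree_C_mul_X_pow_le _ _).trans_lt (by exact_mod_cast Finset.mem_range.1 hi)

theorem sum_Icc_pow_sub {R : Type*} [CommSemiring R] (x : R) (n : ℕ) :
    ∑ i ∈ Finset.Icc 1 n, x ^ (n - i) = ∑ i ∈ Finset.range n, x ^ i := by
  rw [← Finset.sum_range_reflect, ← Finset.Ico_add_one_right_eq_Icc,
    Finset.sum_Ico_eq_sum_range]
  exact Finset.sum_congr rfl fun i _ => by congr 1; omega

theorem aeval_eq_zero_iff_dvd {K : Type*} [Field K] [NumberField K]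
    {θ : NumberField.RingOfIntegers K} {F : ℤ[X]} (hmon : F.Monic)
    (hirr : Irreducible (F.map (algebraMap ℤ ℚ))) (hθ : aeval θ F = 0) (g : ℤ[X]) :
    aeval θ g = 0 ↔ F ∣ g := by
  refine ⟨fun hg => ?_, fun ⟨q, hq⟩ => by rw [hq, map_mul, hθ, zero_mul]⟩
  have key (f : ℤ[X]) (hf : aeval θ f = 0) : aeval (θ : K) (f.map (algebraMap ℤ ℚ)) = 0 := by
    rw [aeval_map_algebraMap]
    exact (aeval_algebraMap_apply K θ f).trans (by rw [hf, map_zero])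
  rw [← map_dvd_map (algebraMap ℤ ℚ) Int.cast_injective hmon,
    minpoly.eq_of_irreducible_of_monic hirr (key F hθ) (hmon.map _)]
  exact minpoly.dvd _ _ (key g hg)

theorem stmt_7
    (n k : ℕ) (hn : 3 ≤ n) (hk : 1 ≤ k) (a b c : ℤ)
    (F : Polynomial ℤ)
    (hF : F = (X ^ k + C b) ^ n +
        C c * ∑ i ∈ Finset.Icc 1 n, (C a * (X ^ k + C b)) ^ (n - i))
    (hFdeg : F.natDegree = n * k)
    (hFirr : Irreducible (F.map (algebraMap ℤ ℚ)))
    (K : Type*) [Field K] [NumberField K]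
    (θ : NumberField.RingOfIntegers K)
    (hθ : aeval θ F = 0)
    (hgen : Algebra.adjoin ℚ {(θ : K)} = ⊤)
    (D : ℤ) (hD : IsDiscriminant F D)
    (p : ℕ) (hp : p.Prime) (hpD : (p : ℤ) ∣ D)
    (hpck : ¬ (p : ℤ) ∣ c * (k : ℤ)) (hpan : (p : ℤ) ∣ a * (n : ℤ))
    (hpgcd : ¬ p ∣ Int.gcd a (n : ℤ)) :
    (¬ p ∣ (Algebra.adjoin ℤ {θ}).toSubring.toAddSubgroup.index) ↔
      (2 ≤ k → ¬ (p : ℤ) ^ 2 ∣ (b ^ n + c * ∑ i ∈ Finset.Icc 1 n, (a * b) ^ (n - i))) := by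
  set f : ℤ[X] := X ^ n + C c * ∑ i ∈ Finset.range n, (C a * X) ^ i with hf
  have hfmon : f.Monic := monic_X_pow_add_geom_sum a c n
  have hFf : F = f.comp (X ^ k + C b) := by
    rw [hF, sum_Icc_pow_sub, hf]
    simp [sum_comp]
  have hfb : b ^ n + c * ∑ i ∈ Finset.Icc 1 n, (a * b) ^ (n - i) = f.eval b := by
    rw [sum_Icc_pow_sub, hf]
    simp [eval_finsetSum]
  have hFmon : F.Monic := hFf ▸ hfmon.comp (monic_X_pow_add_C b (by omega)) (by
    rw [natDegree_X_pow_add_C]; omega)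
  have hdvd := aeval_eq_zero_iff_dvd hFmon hFirr hθ
  rw [hFf] at hdvd
  have : Fact p.Prime := ⟨hp⟩
  have hpc : ¬ (p : ℤ) ∣ c := fun h => hpck (h.mul_right _)
  have hpk : ¬ p ∣ k := fun h => hpck ((Int.natCast_dvd_natCast.2 h).mul_left _)
  have hsep : IsCoprime (f.map (Int.castRingHom (ZMod p)))
      (derivative (f.map (Int.castRingHom (ZMod p)))) := by
    have hfm : f.map (Int.castRingHom (ZMod p)) =
        X ^ n + C (c : ZMod p) * ∑ i ∈ Finset.range n, (C (a : ZMod p) * X) ^ i := by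
      rw [hf]; simp [Polynomial.map_sum]
    rw [hfm]
    have ha : (a : ZMod p) = 0 ↔ (p : ℤ) ∣ a := ZMod.intCast_zmod_eq_zero_iff_dvd a p
    have hn' : (n : ZMod p) = 0 ↔ (p : ℤ) ∣ n := by
      rw [ZMod.natCast_eq_zero_iff, Int.natCast_dvd_natCast]
    refine isCoprime_derivative_X_pow_add_geom_sum _ _
      (by rwa [Ne, ZMod.intCast_zmod_eq_zero_iff_dvd]) n (by omega) ?_
    rw [Ne, Ne, ha, hn']
    have hnot : ¬ ((p : ℤ) ∣ a ∧ (p : ℤ) ∣ n) := fun h =>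
      hpgcd (Int.natCast_dvd_natCast.1 (Int.dvd_coe_gcd h.1 h.2))
    have hor := (Nat.prime_iff_prime_int.1 hp).dvd_or_dvd hpan
    tauto
  have hfin := finite_quotient_adjoin θ hgen
  rw [prime_dvd_index_iff _ hp, hfb, ← not_iff_not, not_not]
  push Not
  constructor
  · rintro ⟨α, hα, hpα⟩
    rw [nsmul_eq_mul] at hpα
    exact sq_dvd_of_not_maximal hfmon hp hpk hdvd hsep hα hpα
  · rintro ⟨hk2, h2⟩
    obtain ⟨α, hα, hpα⟩ := exists_smul_mem_of_sq_dvd hfmon hp hk2 hdvd h2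
    rw [← nsmul_eq_mul] at hpα
    exact ⟨α, hα, hpα⟩
end
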